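/- Let X be simple and k, ℓ ≥ 1. Then β(X^(kℓ)) = κ · β(X^(ℓ)) for some positive integer κ that is a divisor of β(X^(k)). -/

import Mathlib

open MeasureTheory Filter Set ProbabilityTheory

/-- A discrete-time Markov chain on a state space `S`: a stochastic transition
matrix `P`, an initial distribution `init`, and the induced probability measure
`μ` on the path space `ℕ → S`, determined by its values on cylinder sets. -/
structure MarkovChain (S : Type) [MeasurableSpace S] where
  P : S → S → ℝ
  P_nonneg : ∀ i j, 0 ≤ P i j
  P_stochastic : ∀ i, HasSum (P i) 1
  init : S → ℝ
  init_nonneg : ∀ i, 0 ≤ init i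
  init_hasSum : HasSum init 1
  μ : Measure (ℕ → S)
  μ_prob : IsProbabilityMeasure μ
  μ_cylinder : ∀ (n : ℕ) (s : ℕ → S),
    μ {ω | ∀ k ≤ n, ω k = s k}
      = ENNReal.ofReal (init (s 0) * ∏ k ∈ Finset.range n, P (s k) (s (k + 1)))

namespace MarkovChain

variable {S : Type} [MeasurableSpace S]

open Classical in
/-- The `n`-step transition probabilities `P^n(i,j)`. -/
noncomputable def Pn (X : MarkovChain S) : ℕ → S → S → ℝ
  | 0, i, j => if i = j then 1 else 0
  | n + 1, i, j => ∑' k : S, X.Pn n i k * X.P k j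

/-- Irreducibility: every state can be reached from every state. -/
def Irreducible (X : MarkovChain S) : Prop := ∀ i j : S, ∃ n : ℕ, 0 < X.Pn n i j

/-- Aperiodicity: for each state, the gcd of the set `{n ≥ 1 | P^n(i,i) > 0}`
is `1` (expressed via common divisors). -/
def Aperiodic (X : MarkovChain S) : Prop :=
  ∀ i : S, ∀ d : ℕ, (∀ n : ℕ, 0 < n → 0 < X.Pn n i i → d ∣ n) → d = 1

/-- `U^(m)(C)`: the event that the `m`-step chain visits `C` infinitely often. -/
def U (X : MarkovChain S) (m : ℕ) (C : Set S) : Set (ℕ → S) :=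
  {ω | ∀ n : ℕ, ∃ k : ℕ, n ≤ k ∧ ω (k * m) ∈ C}

/-- `L^(m)(C)`: the event that the `m`-step chain is eventually in `C`. -/
def L (X : MarkovChain S) (m : ℕ) (C : Set S) : Set (ℕ → S) :=
  {ω | ∃ n : ℕ, ∀ k : ℕ, n ≤ k → ω (k * m) ∈ C}

/-- `C` is transient with respect to the `m`-step chain `X^(m)`. -/
def Transient (X : MarkovChain S) (m : ℕ) (C : Set S) : Prop := X.μ (X.U m C) = 0

/-- `C` is regular with respect to `X^(m)`: `U^(m)(C)` and `L^(m)(C)` agree up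
to a null event. -/
def Regular (X : MarkovChain S) (m : ℕ) (C : Set S) : Prop :=
  X.μ (symmDiff (X.U m C) (X.L m C)) = 0

/-- `C` is almost closed with respect to `X^(m)`: regular but not transient. -/
def AlmostClosed (X : MarkovChain S) (m : ℕ) (C : Set S) : Prop :=
  X.Regular m C ∧ ¬ X.Transient m C

/-- An almost closed set is atomic if it does not contain two disjoint almost
closed subsets. -/
def Atomic (X : MarkovChain S) (m : ℕ) (C : Set S) : Prop :=
  X.AlmostClosed m C ∧
    ¬ ∃ A B : Set S, A ⊆ C ∧ B ⊆ C ∧ Disjoint A B ∧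
      X.AlmostClosed m A ∧ X.AlmostClosed m B

/-- A Blackwell decomposition for the `m`-step chain `X^(m)`: a countable
collection of pairwise disjoint almost closed sets, all atomic except at most
one, where a nonatomic member contains no atomic subsets and consists of
transient states, and such that the probabilities `μ(L^(m)(C))` sum to one. -/
structure IsBlackwell (X : MarkovChain S) (m : ℕ) (𝒞 : Set (Set S)) : Prop where
  countable : 𝒞.Countable
  almostClosed : ∀ C ∈ 𝒞, X.AlmostClosed m C
  disjoint : 𝒞.PairwiseDisjoint id
  atMostOneNonatomic : ∀ C₁ ∈ 𝒞, ∀ C₂ ∈ 𝒞, ¬ X.Atomic m C₁ → ¬ X.Atomic m C₂ → C₁ = C₂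
  nonatomicNoAtomicSubset : ∀ C ∈ 𝒞, ¬ X.Atomic m C → ∀ A : Set S, A ⊆ C → ¬ X.Atomic m A
  nonatomicTransientStates : ∀ C ∈ 𝒞, ¬ X.Atomic m C → ∀ i ∈ C, X.Transient m {i}
  sum_L_eq_one : ∑' C : 𝒞, X.μ (X.L m (C : Set S)) = 1

/-- `β(X^(m))`: the number of sets in a Blackwell decomposition for `X^(m)`
(well defined since the decomposition is unique up to equivalence). -/
noncomputable def beta (X : MarkovChain S) (m : ℕ) : ℕ∞ :=
  sInf (Set.encard '' {𝒞 : Set (Set S) | X.IsBlackwell m 𝒞})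

/-- `X` is simple if `β(X) = 1`. -/
def Simple (X : MarkovChain S) : Prop := X.beta 1 = 1

/-- The asymptotic period `d(X) = sup {m ≥ 1 | β(X^(m)) = m}` (possibly `∞`). -/
noncomputable def period (X : MarkovChain S) : ℕ∞ :=
  sSup {d : ℕ∞ | ∃ m : ℕ, 1 ≤ m ∧ X.beta m = (m : ℕ∞) ∧ d = (m : ℕ∞)}

/-- Recurrence: every state is visited infinitely often almost surely. -/
def Recurrent (X : MarkovChain S) : Prop := ∀ i : S, X.μ (X.U 1 {i}) = 1

end MarkovChain

/-- The shift operator `θ` on path space: `(θ ω)(n) = ω(n+1)`. -/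
def pathShift {S : Type} : (ℕ → S) → ℕ → S := fun ω n => ω (n + 1)

/-- An event `E` is `m`-invariant if its indicator function `f` satisfies
`f(ω) = f(θ^m ω)` for all paths `ω`. -/
def MInvariant {S : Type} (m : ℕ) (E : Set (ℕ → S)) : Prop :=
  ∀ ω : ℕ → S, ω ∈ E ↔ pathShift^[m] ω ∈ E

/-- A birth-death process: a Markov chain on `ℕ` with positive birth
probabilities `p_i = P(i,i+1)`, positive death probabilities `q_{i+1} = P(i+1,i)`,
all transition probabilities other than `p_i`, `q_i` and `r_i = P(i,i)` zero,
and at least one positive self-transition probability. -/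
structure MarkovChain.IsBirthDeath (X : MarkovChain ℕ) : Prop where
  birth_pos : ∀ i : ℕ, 0 < X.P i (i + 1)
  death_pos : ∀ i : ℕ, 0 < X.P (i + 1) i
  tridiagonal : ∀ i j : ℕ, 1 < |(i : ℤ) - (j : ℤ)| → X.P i j = 0
  self_pos : ∃ i : ℕ, 0 < X.P i i

theorem pathShift_iterate_apply {S : Type} (n : ℕ) (ω : ℕ → S) (k : ℕ) :
    pathShift^[n] ω k = ω (k + n) := by
  induction n generalizing ω with
  | zero => rfl
  | succ n ih =>
    rw [Function.iterate_succ_apply, ih]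
    simp [pathShift, add_assoc]

theorem measurable_pathShift {S : Type} [MeasurableSpace S] :
    Measurable (pathShift : (ℕ → S) → ℕ → S) :=
  measurable_pi_lambda _ fun n => measurable_pi_apply (n + 1)

namespace MarkovChain

/-- The paths that agree with `s` up to time `n`. -/
def cyl {S : Type} (n : ℕ) (s : ℕ → S) : Set (ℕ → S) := {ω | ∀ k ≤ n, ω k = s k}

theorem exists_preimage_frestrictLe_eq_cyl {S : Type} (n : ℕ) (x : Finset.Iic n → S) :
    ∃ s : ℕ → S, Preorder.frestrictLe (π := fun _ => S) n ⁻¹' {x} = cyl n s := by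
  refine ⟨fun k => if h : k ≤ n then x ⟨k, Finset.mem_Iic.2 h⟩ else
    x ⟨0, Finset.mem_Iic.2 (Nat.zero_le n)⟩, ?_⟩
  ext ω
  simp only [mem_preimage, mem_singleton_iff, cyl, mem_ofPred_eq, funext_iff, Subtype.forall,
    Finset.mem_Iic, Preorder.frestrictLe_apply]
  refine forall₂_congr fun k hk => ?_
  rw [dif_pos hk]

section Cylinders

variable {S : Type} [MeasurableSpace S] [MeasurableSingletonClass S]

theorem measurableSet_cyl (n : ℕ) (s : ℕ → S) : MeasurableSet (cyl n s) := by
  have : cyl n s = ⋂ k ∈ Iic n, (fun ω : ℕ → S => ω k) ⁻¹' {s k} := by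
    ext ω; simp [cyl]
  rw [this]
  exact MeasurableSet.biInter (to_countable _)
    fun k _ => measurable_pi_apply k (measurableSet_singleton _)

variable [Countable S]

theorem map_frestrictLe_eq_of_cyl {ν₁ ν₂ : Measure (ℕ → S)} (n : ℕ)
    (h : ∀ s, ν₁ (cyl n s) = ν₂ (cyl n s)) :
    ν₁.map (Preorder.frestrictLe (π := fun _ => S) n)
      = ν₂.map (Preorder.frestrictLe (π := fun _ => S) n) := by
  rw [Measure.ext_iff_singleton]
  intro x
  rw [Measure.map_apply (Preorder.measurable_frestrictLe n) (measurableSet_singleton x),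
    Measure.map_apply (Preorder.measurable_frestrictLe n) (measurableSet_singleton x)]
  obtain ⟨s, hs⟩ := exists_preimage_frestrictLe_eq_cyl n x
  rw [hs, h]

theorem measure_ext_of_cyl {ν₁ ν₂ : Measure (ℕ → S)} [IsFiniteMeasure ν₁]
    (h : ∀ n s, ν₁ (cyl n s) = ν₂ (cyl n s)) : ν₁ = ν₂ := by
  refine IsProjectiveLimit.unique (P := fun I : Finset ℕ => ν₁.map I.restrict)
    (fun _ => rfl) fun I => ?_
  have hI := I.subset_Iic_sup_id
  have h1 := congrArg (Measure.map (Finset.restrict₂ (π := fun _ : ℕ => S) hI))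
    (map_frestrictLe_eq_of_cyl (I.sup id) (h _))
  rw [Measure.map_map (by fun_prop) (by fun_prop), Measure.map_map (by fun_prop) (by fun_prop)]
    at h1
  exact h1.symm

end Cylinders

section PathLaw

variable {S : Type} [MeasurableSpace S] (X : MarkovChain S)

instance : IsProbabilityMeasure X.μ := X.μ_prob

theorem measure_cyl (n : ℕ) (s : ℕ → S) : X.μ (cyl n s)
    = ENNReal.ofReal (X.init (s 0) * ∏ k ∈ Finset.range n, X.P (s k) (s (k + 1))) :=
  X.μ_cylinder n s

open Classical in
theorem measure_cyl_inter_preimage_cyl (n N : ℕ) (s t : ℕ → S) :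
    X.μ (cyl n s ∩ pathShift^[n] ⁻¹' cyl N t) = X.μ (cyl n s) *
      if t 0 = s n then ENNReal.ofReal (∏ k ∈ Finset.range N, X.P (t k) (t (k + 1))) else 0 := by
  split_ifs with h
  · set u : ℕ → S := fun k => if k ≤ n then s k else t (k - n) with hu
    have hu1 : ∀ k ≤ n, u k = s k := fun k hk => if_pos hk
    have hu2 : ∀ k, u (n + k) = t k := by
      intro k
      rcases Nat.eq_zero_or_pos k with rfl | hk
      · rw [h]; exact hu1 _ le_rfl
      · simp only [hu, if_neg (show ¬ n + k ≤ n by lia), Nat.add_sub_cancel_left]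
    have : cyl n s ∩ pathShift^[n] ⁻¹' cyl N t = cyl (n + N) u := by
      ext ω
      simp only [cyl, mem_inter_iff, mem_ofPred_eq, mem_preimage, pathShift_iterate_apply]
      constructor
      · rintro ⟨h1, h2⟩ k hk
        by_cases hkn : k ≤ n
        · rw [hu1 k hkn, h1 k hkn]
        · obtain ⟨j, rfl⟩ := Nat.exists_eq_add_of_le (not_le.1 hkn).le
          rw [hu2, ← h2 j (by lia), add_comm]
      · intro h1
        exact ⟨fun k hk => by rw [← hu1 k hk, h1 k (by lia)],
          fun k hk => by rw [← hu2, add_comm, h1 _ (by lia)]⟩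
    rw [this, measure_cyl, measure_cyl, ← ENNReal.ofReal_mul, Finset.prod_range_add, hu1 0 (by lia),
      ← mul_assoc]
    · congr 2
      · congr 1
        refine Finset.prod_congr rfl fun k hk => ?_
        rw [hu1 k (Finset.mem_range.1 hk).le, hu1 (k + 1) (Finset.mem_range.1 hk)]
      · refine Finset.prod_congr rfl fun k hk => ?_
        rw [hu2, add_assoc, hu2]
    · exact mul_nonneg (X.init_nonneg _) (Finset.prod_nonneg fun _ _ => X.P_nonneg _ _)
  · rw [mul_zero]
    refine measure_mono_null (fun ω hω => h ?_) (measure_empty (μ := X.μ))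
    have h1 := hω.1 n le_rfl
    have h2 := hω.2 0 (Nat.zero_le _)
    rw [pathShift_iterate_apply, zero_add] at h2
    rw [← h2, h1]

/-- The law of the future of the chain after it has followed `s` up to time `n`. -/
noncomputable def futureLaw (n : ℕ) (s : ℕ → S) : Measure (ℕ → S) :=
  (X.μ (cyl n s))⁻¹ • (X.μ.restrict (cyl n s)).map pathShift^[n]

open Classical in
/-- The law of the chain started at `i`, for a state `i` that the chain may visit. -/
noncomputable def pathLaw (i : S) : Measure (ℕ → S) :=
  if h : ∃ p : ℕ × (ℕ → S), p.2 p.1 = i ∧ X.μ (cyl p.1 p.2) ≠ 0 then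
    X.futureLaw h.choose.1 h.choose.2 else 0

theorem futureLaw_apply (n : ℕ) (s : ℕ → S) {B : Set (ℕ → S)} (hB : MeasurableSet B) :
    X.futureLaw n s B = (X.μ (cyl n s))⁻¹ * X.μ (cyl n s ∩ pathShift^[n] ⁻¹' B) := by
  have hm := measurable_pathShift.iterate (α := ℕ → S) n
  rw [futureLaw, Measure.smul_apply, Measure.map_apply hm hB, Measure.restrict_apply (hm hB),
    inter_comm, smul_eq_mul]

instance (n : ℕ) (s : ℕ → S) : IsFiniteMeasure (X.futureLaw n s) := by
  constructor
  rw [futureLaw_apply X n s MeasurableSet.univ, preimage_univ, inter_univ]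
  exact (ENNReal.inv_mul_le_one _).trans_lt ENNReal.one_lt_top

theorem pathLaw_le_one (i : S) {B : Set (ℕ → S)} (hB : MeasurableSet B) : X.pathLaw i B ≤ 1 := by
  rw [pathLaw]
  split_ifs with h
  · rw [futureLaw_apply X _ _ hB]
    refine le_trans ?_ (ENNReal.inv_mul_le_one (X.μ (cyl h.choose.1 h.choose.2)))
    gcongr
    exact inter_subset_left
  · simp

variable [MeasurableSingletonClass S] [Countable S]

theorem futureLaw_eq {n n' : ℕ} {s s' : ℕ → S} (h : s n = s' n') (h1 : X.μ (cyl n s) ≠ 0)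
    (h2 : X.μ (cyl n' s') ≠ 0) : X.futureLaw n s = X.futureLaw n' s' := by
  refine measure_ext_of_cyl fun N t => ?_
  rw [futureLaw_apply X _ _ (measurableSet_cyl N t), futureLaw_apply X _ _ (measurableSet_cyl N t),
    measure_cyl_inter_preimage_cyl, measure_cyl_inter_preimage_cyl, ← mul_assoc, ← mul_assoc,
    ENNReal.inv_mul_cancel h1 (measure_ne_top _ _), ENNReal.inv_mul_cancel h2 (measure_ne_top _ _),
    h]

theorem measure_cyl_inter_preimage (n : ℕ) (s : ℕ → S) {B : Set (ℕ → S)} (hB : MeasurableSet B) :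
    X.μ (cyl n s ∩ pathShift^[n] ⁻¹' B) = X.μ (cyl n s) * X.pathLaw (s n) B := by
  by_cases h0 : X.μ (cyl n s) = 0
  · rw [h0, zero_mul]
    exact measure_mono_null inter_subset_left h0
  have h : ∃ p : ℕ × (ℕ → S), p.2 p.1 = s n ∧ X.μ (cyl p.1 p.2) ≠ 0 := ⟨(n, s), rfl, h0⟩
  rw [pathLaw, dif_pos h, ← futureLaw_eq X h.choose_spec.1.symm h0 h.choose_spec.2,
    futureLaw_apply X _ _ hB, ← mul_assoc, ENNReal.mul_inv_cancel h0 (measure_ne_top _ _), one_mul]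

theorem measurable_pathLaw_apply (n : ℕ) (B : Set (ℕ → S)) :
    Measurable fun ω : ℕ → S => X.pathLaw (ω n) B :=
  (measurable_of_countable fun i => X.pathLaw i B).comp (measurable_pi_apply n)

/-- The Markov property at a fixed time. -/
theorem measure_inter_preimage (n : ℕ) {A B : Set (ℕ → S)}
    (hA : MeasurableSet[Filtration.piLE (X := fun _ => S) n] A) (hB : MeasurableSet B) :
    X.μ (A ∩ pathShift^[n] ⁻¹' B) = ∫⁻ ω in A, X.pathLaw (ω n) B ∂X.μ := by
  rw [Filtration.piLE_eq_comap_frestrictLe] at hA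
  obtain ⟨D, hD, rfl⟩ := hA
  have hm := measurable_pathShift.iterate (α := ℕ → S) n
  have hr := Preorder.measurable_frestrictLe (X := fun _ => S) n
  have key := map_frestrictLe_eq_of_cyl (ν₁ := X.μ.restrict (pathShift^[n] ⁻¹' B))
    (ν₂ := X.μ.withDensity fun ω => X.pathLaw (ω n) B) n fun s => by
      rw [Measure.restrict_apply (measurableSet_cyl n s),
        withDensity_apply _ (measurableSet_cyl n s), measure_cyl_inter_preimage X n s hB,
        setLIntegral_congr_fun (g := fun _ => X.pathLaw (s n) B) (measurableSet_cyl n s)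
          fun ω hω => by simp only [hω n le_rfl],
        setLIntegral_const, mul_comm]
  have := congrArg (fun ν => ν D) key
  simp only at this
  rw [Measure.map_apply hr hD, Measure.map_apply hr hD, Measure.restrict_apply (hr hD),
    withDensity_apply _ (hr hD)] at this
  exact this

theorem measure_preimage (n : ℕ) {B : Set (ℕ → S)} (hB : MeasurableSet B) :
    X.μ (pathShift^[n] ⁻¹' B) = ∫⁻ ω, X.pathLaw (ω n) B ∂X.μ := by
  simpa using X.measure_inter_preimage n (@MeasurableSet.univ _ (Filtration.piLE n)) hB

end PathLaw

end MarkovChain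

namespace MarkovChain

section Reach

variable {S : Type} [MeasurableSpace S] (X : MarkovChain S)

/-- `j` can be reached from `i` in exactly `n` steps. -/
def Reach (n : ℕ) (i j : S) : Prop :=
  ∃ s : ℕ → S, s 0 = i ∧ s n = j ∧ ∀ k < n, 0 < X.P (s k) (s (k + 1))

variable {X}

theorem Reach.refl (i : S) : X.Reach 0 i i := ⟨fun _ => i, rfl, rfl, by simp⟩

theorem Reach.add {a b : ℕ} {i j l : S} (h1 : X.Reach a i j) (h2 : X.Reach b j l) :
    X.Reach (a + b) i l := by
  obtain ⟨s, hs0, hsa, hs⟩ := h1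
  obtain ⟨t, ht0, htb, ht⟩ := h2
  refine ⟨fun k => if k ≤ a then s k else t (k - a), by simpa, ?_, fun k hk => ?_⟩
  · rcases Nat.eq_zero_or_pos b with rfl | hb
    · simpa [hsa, ← htb] using ht0.symm
    · simpa [show ¬ b = 0 by lia] using htb
  · rcases lt_trichotomy k a with h | h | h
    · simp only [if_pos h.le, if_pos (show k + 1 ≤ a from h)]
      exact hs k h
    · subst h
      simp only [if_pos le_rfl, if_neg (show ¬ k + 1 ≤ k by lia), Nat.add_sub_cancel_left]
      rw [hsa, ← ht0]
      exact ht 0 (by lia)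
    · simp only [if_neg (show ¬ k ≤ a by lia), if_neg (show ¬ k + 1 ≤ a by lia)]
      rw [show k + 1 - a = k - a + 1 by lia]
      exact ht _ (by lia)

theorem Reach.mul {a : ℕ} {i : S} (h : X.Reach a i i) (c : ℕ) : X.Reach (c * a) i i := by
  induction c with
  | zero => simpa using Reach.refl i
  | succ c ih => simpa [add_mul] using ih.add h

theorem Pn_nonneg (n : ℕ) (i j : S) : 0 ≤ X.Pn n i j := by
  induction n generalizing j with
  | zero => simp only [Pn]; split_ifs <;> simp
  | succ n ih => exact tsum_nonneg fun k => mul_nonneg (ih k) (X.P_nonneg _ _)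

theorem reach_of_Pn_pos {n : ℕ} {i j : S} (h : 0 < X.Pn n i j) : X.Reach n i j := by
  induction n generalizing j with
  | zero =>
    by_cases hij : i = j
    · subst hij; exact Reach.refl i
    · simp [Pn, hij] at h
  | succ n ih =>
    obtain ⟨k, hk⟩ : ∃ k, X.Pn n i k * X.P k j ≠ 0 := by
      by_contra! h0
      simp [Pn, h0] at h
    refine (ih ((Pn_nonneg n i k).lt_of_ne (left_ne_zero_of_mul hk).symm)).add
      ⟨fun l => if l = 0 then k else j, by simp, by simp, fun l hl => ?_⟩
    obtain rfl : l = 0 := by lia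
    simpa using (X.P_nonneg k j).lt_of_ne (right_ne_zero_of_mul hk).symm

theorem Aperiodic.exists_dvd_reach (hap : X.Aperiodic) (i : S) {m : ℕ} (hm : 1 ≤ m) (r : ℕ) :
    ∃ n, m ∣ n + r ∧ X.Reach n i i := by
  let H : AddSubgroup ℤ :=
    { carrier := {z | ∃ n : ℕ, (m : ℤ) ∣ z - n ∧ X.Reach n i i}
      zero_mem' := ⟨0, by simp, Reach.refl i⟩
      add_mem' := by
        rintro a b ⟨n, hn, h⟩ ⟨n', hn', h'⟩
        refine ⟨n + n', ?_, h.add h'⟩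
        push_cast
        rw [add_sub_add_comm]
        exact dvd_add hn hn'
      neg_mem' := by
        rintro a ⟨n, ⟨c, hc⟩, h⟩
        refine ⟨(m - 1) * n, ⟨-c - n, ?_⟩, h.mul _⟩
        push_cast [hm]
        linear_combination -hc }
  obtain ⟨d, hd⟩ := Int.subgroup_cyclic H
  have hd1 : d.natAbs = 1 := hap i _ fun n _ hn => by
    have : (n : ℤ) ∈ H := ⟨n, by simp, reach_of_Pn_pos hn⟩
    rw [hd, AddSubgroup.mem_closure_singleton] at this
    obtain ⟨c, hc⟩ := this
    rw [← Int.natCast_dvd_natCast, Int.natAbs_dvd, ← hc, smul_eq_mul]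
    exact dvd_mul_left _ _
  have : (-r : ℤ) ∈ H := by
    rw [hd, AddSubgroup.mem_closure_singleton]
    rcases Int.natAbs_eq d with h | h <;> rw [hd1] at h
    · exact ⟨-r, by simp [h]⟩
    · exact ⟨r, by simp [h]⟩
  obtain ⟨n, hn, h⟩ := this
  refine ⟨n, ?_, h⟩
  rw [← Int.natCast_dvd_natCast, ← dvd_neg]
  push_cast
  rwa [neg_add_rev, ← sub_eq_add_neg]

theorem exists_measure_cyl_ne_zero (hirr : X.Irreducible) (hap : X.Aperiodic) {m : ℕ}
    (hm : 1 ≤ m) (i : S) : ∃ (N : ℕ) (s : ℕ → S), s (N * m) = i ∧ X.μ (cyl (N * m) s) ≠ 0 := by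
  obtain ⟨j, hj⟩ : ∃ j, X.init j ≠ 0 := by
    by_contra! h
    have := X.init_hasSum
    rw [show X.init = fun _ => 0 from funext h] at this
    exact zero_ne_one (hasSum_zero.unique this)
  obtain ⟨r, hr⟩ := hirr j i
  obtain ⟨n, ⟨N, hN⟩, hn⟩ := hap.exists_dvd_reach i hm r
  have := (reach_of_Pn_pos hr).add hn
  rw [add_comm, hN, mul_comm] at this
  obtain ⟨s, hs0, hsn, hs⟩ := this
  refine ⟨N, s, hsn, ?_⟩
  rw [measure_cyl, hs0, ENNReal.ofReal_ne_zero_iff]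
  exact mul_pos ((X.init_nonneg j).lt_of_ne hj.symm)
    (Finset.prod_pos fun k hk => hs k (Finset.mem_range.1 hk))

end Reach

end MarkovChain

section Invariant

variable {S : Type}

theorem minvariant_iff_preimage_eq {m : ℕ} {E : Set (ℕ → S)} :
    MInvariant m E ↔ pathShift^[m] ⁻¹' E = E :=
  ⟨fun h => Set.ext fun ω => (h ω).symm, fun h ω => (Set.ext_iff.1 h ω).symm⟩

theorem MInvariant.preimage_eq {m : ℕ} {E : Set (ℕ → S)} (h : MInvariant m E) :
    pathShift^[m] ⁻¹' E = E :=
  minvariant_iff_preimage_eq.1 h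

theorem MInvariant.mul {m : ℕ} {E : Set (ℕ → S)} (h : MInvariant m E) (N : ℕ) :
    MInvariant (N * m) E := by
  induction N with
  | zero => intro ω; simp
  | succ N ih =>
    intro ω
    rw [add_mul, one_mul, Function.iterate_add_apply, ← ih, ← h]

end Invariant

namespace MarkovChain

/-- The filtration generated by the `m`-step chain and the intermediate states. -/
def stepFiltration (S : Type) [MeasurableSpace S] (m : ℕ) :
    Filtration ℕ (MeasurableSpace.pi (X := fun _ : ℕ => S)) where
  seq k := Filtration.piLE (X := fun _ => S) (k * m)
  mono' _ _ h := Filtration.piLE.mono (Nat.mul_le_mul_right m h)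
  le' _ := Filtration.piLE.le _

theorem measurable_eval_piLE {S : Type} [MeasurableSpace S] (n : ℕ) :
    Measurable[Filtration.piLE (X := fun _ => S) n] fun ω : ℕ → S => ω n := by
  rw [Filtration.piLE_eq_comap_frestrictLe]
  exact (measurable_pi_apply (⟨n, Finset.mem_Iic.2 le_rfl⟩ : Finset.Iic n)).comp
    (comap_measurable (Preorder.frestrictLe (π := fun _ => S) n))

theorem le_iSup_stepFiltration {S : Type} [MeasurableSpace S] {m : ℕ} (hm : 1 ≤ m) :
    (MeasurableSpace.pi : MeasurableSpace (ℕ → S)) ≤ ⨆ k, stepFiltration S m k := by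
  refine iSup_le fun k => ?_
  refine le_trans (measurable_eval_piLE k).comap_le ?_
  refine le_trans ?_ (le_iSup _ k)
  exact Filtration.piLE.mono (Nat.le_mul_of_pos_right k hm)

variable {S : Type} [MeasurableSpace S] [MeasurableSingletonClass S] [Countable S]
  {X : MarkovChain S}

theorem pathLaw_eq_zero_of_minvariant (hirr : X.Irreducible) (hap : X.Aperiodic) {m : ℕ}
    (hm : 1 ≤ m) {E : Set (ℕ → S)} (hE : MeasurableSet E) (hinv : MInvariant m E)
    (h0 : X.μ E = 0) (i : S) : X.pathLaw i E = 0 := by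
  obtain ⟨N, s, rfl, hs⟩ := exists_measure_cyl_ne_zero hirr hap hm i
  have := X.measure_cyl_inter_preimage (N * m) s hE
  rw [(hinv.mul N).preimage_eq, measure_mono_null inter_subset_right h0] at this
  exact (mul_eq_zero.1 this.symm).resolve_left hs

theorem measure_preimage_eq_zero_of_minvariant (hirr : X.Irreducible) (hap : X.Aperiodic) {m : ℕ}
    (hm : 1 ≤ m) {E : Set (ℕ → S)} (hE : MeasurableSet E) (hinv : MInvariant m E)
    (h0 : X.μ E = 0) (j : ℕ) : X.μ (pathShift^[j] ⁻¹' E) = 0 := by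
  rw [X.measure_preimage j hE]
  simp [pathLaw_eq_zero_of_minvariant hirr hap hm hE hinv h0]

theorem condExp_indicator_eq {m : ℕ} {E : Set (ℕ → S)} (hE : MeasurableSet E)
    (hinv : MInvariant m E) (k : ℕ) : (fun ω => (X.pathLaw (ω (k * m)) E).toReal) =ᵐ[X.μ]
      X.μ[E.indicator fun _ => (1 : ℝ) | stepFiltration S m k] := by
  have hmeas := X.measurable_pathLaw_apply (k * m) E
  have hint : Integrable (fun ω => (X.pathLaw (ω (k * m)) E).toReal) X.μ :=
    Integrable.of_bound hmeas.ennreal_toReal.aestronglyMeasurable 1 <| .of_forall fun ω => by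
      rw [Real.norm_of_nonneg ENNReal.toReal_nonneg]
      exact ENNReal.toReal_mono ENNReal.one_ne_top (X.pathLaw_le_one _ hE)
  refine ae_eq_condExp_of_forall_setIntegral_eq ((stepFiltration S m).le k)
    ((integrable_const 1).indicator hE) (fun _ _ _ => hint.integrableOn) (fun A hA _ => ?_) ?_
  · have h1 := X.measure_inter_preimage (k * m) hA hE
    rw [(hinv.mul k).preimage_eq] at h1
    rw [integral_toReal hmeas.aemeasurable, ← h1, setIntegral_indicator hE]
    · simp [Measure.real]
    · exact .of_forall fun ω => (X.pathLaw_le_one _ hE).trans_lt ENNReal.one_lt_top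
  · exact (((measurable_of_countable fun i => (X.pathLaw i E).toReal).comp
      (measurable_eval_piLE (k * m))).stronglyMeasurable).aestronglyMeasurable

variable (X) in
/-- `C` represents the event `E` for the `m`-step chain: almost surely the `m`-step chain visits `C`
infinitely often iff it eventually stays in `C` iff `E` occurs. -/
def Represents (m : ℕ) (C : Set S) (E : Set (ℕ → S)) : Prop :=
  X.U m C =ᵐ[X.μ] E ∧ X.L m C =ᵐ[X.μ] E

theorem exists_represents {m : ℕ} (hm : 1 ≤ m) {E : Set (ℕ → S)} (hE : MeasurableSet E)
    (hinv : MInvariant m E) : ∃ C, X.Represents m C E := by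
  refine ⟨{i | 1 / 2 < (X.pathLaw i E).toReal}, ?_⟩
  have hlim := Integrable.tendsto_ae_condExp (μ := X.μ) (ℱ := stepFiltration S m)
    (g := E.indicator fun _ => (1 : ℝ)) ((integrable_const 1).indicator hE)
    (stronglyMeasurable_const.indicator (le_iSup_stepFiltration hm _ hE))
  have hall := ae_all_iff.2 fun k => condExp_indicator_eq (X := X) hE hinv k
  have key : ∀ᵐ ω ∂X.μ, (ω ∈ E → ω ∈ X.L m {i | 1 / 2 < (X.pathLaw i E).toReal}) ∧
      (ω ∈ X.U m {i | 1 / 2 < (X.pathLaw i E).toReal} → ω ∈ E) := by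
    filter_upwards [hlim, hall] with ω h1 h2
    replace h1 := h1.congr fun k => (h2 k).symm
    constructor
    · intro hω
      rw [indicator_of_mem hω] at h1
      exact eventually_atTop.1 (h1.eventually_const_lt (by norm_num : (1 / 2 : ℝ) < 1))
    · intro hU
      by_contra hω
      rw [indicator_of_notMem hω] at h1
      obtain ⟨n, hn⟩ := eventually_atTop.1 (h1.eventually_lt_const (by norm_num : (0 : ℝ) < 1 / 2))
      obtain ⟨k, hk, hkU⟩ := hU n
      exact lt_asymm (hn k hk) hkU
  have hLU : ∀ C, X.L m C ⊆ X.U m C := fun C ω ⟨n, hn⟩ k =>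
    ⟨max n k, le_max_right _ _, hn _ (le_max_left _ _)⟩
  constructor <;> filter_upwards [key] with ω hω
  · exact propext ⟨hω.2, fun h => hLU _ (hω.1 h)⟩
  · exact propext ⟨fun h => hω.2 (hLU _ h), hω.1⟩

end MarkovChain

namespace MarkovChain

section LU

variable {S : Type} [MeasurableSpace S] {X : MarkovChain S} {m : ℕ} {C D : Set S}

theorem L_subset_U : X.L m C ⊆ X.U m C := fun _ ⟨n, hn⟩ k =>
  ⟨max n k, le_max_right _ _, hn _ (le_max_left _ _)⟩

theorem L_mono (h : C ⊆ D) : X.L m C ⊆ X.L m D := fun _ ⟨n, hn⟩ => ⟨n, fun k hk => h (hn k hk)⟩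

theorem U_mono (h : C ⊆ D) : X.U m C ⊆ X.U m D := fun _ hω n =>
  let ⟨k, hk, hC⟩ := hω n
  ⟨k, hk, h hC⟩

theorem L_inter : X.L m (C ∩ D) = X.L m C ∩ X.L m D := by
  refine subset_antisymm (subset_inter (L_mono inter_subset_left) (L_mono inter_subset_right)) ?_
  rintro ω ⟨⟨n, hn⟩, ⟨n', hn'⟩⟩
  exact ⟨max n n', fun k hk =>
    ⟨hn k (le_trans (le_max_left _ _) hk), hn' k (le_trans (le_max_right _ _) hk)⟩⟩

theorem U_compl : X.U m Cᶜ = (X.L m C)ᶜ := by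
  ext ω; simp [U, L]

theorem L_compl : X.L m Cᶜ = (X.U m C)ᶜ := by
  ext ω; simp [U, L]

theorem disjoint_L (h : Disjoint C D) : Disjoint (X.L m C) (X.L m D) := by
  rw [Set.disjoint_iff_inter_eq_empty] at h ⊢
  rw [← L_inter, h]
  ext ω
  simp only [L, mem_empty_iff_false, mem_ofPred_eq, iff_false]
  rintro ⟨n, hn⟩
  exact hn n le_rfl

theorem minvariant_L : MInvariant m (X.L m C) := by
  intro ω
  simp only [L, mem_ofPred_eq, pathShift_iterate_apply]
  constructor
  · rintro ⟨n, hn⟩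
    exact ⟨n, fun k hk => by simpa [add_mul] using hn (k + 1) (by lia)⟩
  · rintro ⟨n, hn⟩
    refine ⟨n + 1, fun k hk => ?_⟩
    obtain ⟨j, rfl⟩ : ∃ j, k = j + 1 := ⟨k - 1, by lia⟩
    simpa [add_mul] using hn j (by lia)

theorem measurableSet_L [MeasurableSingletonClass S] [Countable S] :
    MeasurableSet (X.L m C) := by
  have : X.L m C = ⋃ n : ℕ, ⋂ k : ℕ, ⋂ _ : n ≤ k, (fun ω : ℕ → S => ω (k * m)) ⁻¹' C := by
    ext ω; simp [L]
  rw [this]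
  exact MeasurableSet.iUnion fun n => MeasurableSet.iInter fun k => MeasurableSet.iInter fun _ =>
    measurable_pi_apply (k * m) C.to_countable.measurableSet

end LU

section Represents

variable {S : Type} [MeasurableSpace S] {X : MarkovChain S} {m : ℕ} {C D : Set S}
  {E F : Set (ℕ → S)}

theorem Represents.congr (h : X.Represents m C E) (hEF : E =ᵐ[X.μ] F) : X.Represents m C F :=
  ⟨h.1.trans hEF, h.2.trans hEF⟩

theorem Represents.compl (h : X.Represents m C E) : X.Represents m Cᶜ Eᶜ := by
  rw [Represents, U_compl, L_compl]
  exact ⟨h.2.compl, h.1.compl⟩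

theorem Represents.inter (hC : X.Represents m C E) (hD : X.Represents m D F) :
    X.Represents m (C ∩ D) (E ∩ F) := by
  have hL : X.L m (C ∩ D) =ᵐ[X.μ] (E ∩ F : Set (ℕ → S)) := by
    rw [L_inter]
    exact hC.2.inter hD.2
  refine ⟨EventuallyLE.antisymm (EventuallyLE.trans ?_ (hC.1.inter hD.1).le)
    (hL.symm.le.trans L_subset_U.eventuallyLE), hL⟩
  exact (subset_inter (U_mono inter_subset_left) (U_mono inter_subset_right)).eventuallyLE

theorem represents_univ : X.Represents m univ univ := by
  have h : X.L m univ = univ := by ext; simp [L]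
  exact ⟨(univ_subset_iff.1 (h ▸ L_subset_U)).eventuallyEq, h.eventuallyEq⟩

theorem Represents.biInter {ι : Type*} (s : Finset ι) {C : ι → Set S} {E : ι → Set (ℕ → S)}
    (h : ∀ i, X.Represents m (C i) (E i)) :
    X.Represents m (⋂ i ∈ s, C i) (⋂ i ∈ s, E i) := by
  classical
  induction s using Finset.induction_on with
  | empty => simpa using represents_univ
  | insert i s _ ih =>
    rw [Finset.set_biInter_insert, Finset.set_biInter_insert]
    exact (h i).inter ih

theorem regular_iff : X.Regular m C ↔ X.U m C =ᵐ[X.μ] X.L m C :=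
  measure_symmDiff_eq_zero_iff

theorem AlmostClosed.represents (h : X.AlmostClosed m C) : X.Represents m C (X.L m C) :=
  ⟨regular_iff.1 h.1, ae_eq_refl _⟩

theorem Represents.almostClosed_iff (h : X.Represents m C E) :
    X.AlmostClosed m C ↔ X.μ E ≠ 0 := by
  rw [AlmostClosed, regular_iff, Transient, measure_congr h.1]
  exact and_iff_right (h.1.trans h.2.symm)

theorem AlmostClosed.measure_L_ne_zero (h : X.AlmostClosed m C) : X.μ (X.L m C) ≠ 0 :=
  h.represents.almostClosed_iff.1 h

end Represents

section Atoms

variable {S : Type} [MeasurableSpace S]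

/-- `m`-invariant measurable events. -/
def InvEvent (m : ℕ) (E : Set (ℕ → S)) : Prop := MeasurableSet E ∧ MInvariant m E

/-- Atoms of the σ-algebra of `m`-invariant events. -/
def IsAtomEvent (X : MarkovChain S) (m : ℕ) (E : Set (ℕ → S)) : Prop :=
  InvEvent m E ∧ X.μ E ≠ 0 ∧ ∀ G, InvEvent m G → X.μ (G ∩ E) = 0 ∨ X.μ (E \ G) = 0

variable {m : ℕ} {E F : Set (ℕ → S)}

theorem InvEvent.inter (hE : InvEvent m E) (hF : InvEvent m F) : InvEvent m (E ∩ F) :=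
  ⟨hE.1.inter hF.1, fun ω => and_congr (hE.2 ω) (hF.2 ω)⟩

theorem InvEvent.compl (hE : InvEvent m E) : InvEvent m Eᶜ :=
  ⟨hE.1.compl, fun ω => not_congr (hE.2 ω)⟩

theorem InvEvent.diff (hE : InvEvent m E) (hF : InvEvent m F) : InvEvent m (E \ F) :=
  hE.inter hF.compl

theorem InvEvent.mul (hE : InvEvent m E) (k : ℕ) : InvEvent (k * m) E := ⟨hE.1, hE.2.mul k⟩

theorem IsAtomEvent.ae_eq {X : MarkovChain S} (hE : X.IsAtomEvent m E) (hF : X.IsAtomEvent m F)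
    (h : X.μ (E ∩ F) ≠ 0) : E =ᵐ[X.μ] F := by
  refine EventuallyLE.antisymm ?_ ?_
  · exact ae_le_set.2 ((hE.2.2 F hF.1).resolve_left (by rwa [inter_comm]))
  · exact ae_le_set.2 ((hF.2.2 E hE.1).resolve_left h)

variable [MeasurableSingletonClass S] [Countable S] {X : MarkovChain S} {C : Set S}

theorem invEvent_L : InvEvent m (X.L m C) := ⟨measurableSet_L, minvariant_L⟩

theorem Represents.atomic_iff (hm : 1 ≤ m) (hE : InvEvent m E) (h : X.Represents m C E) :
    X.Atomic m C ↔ X.IsAtomEvent m E := by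
  constructor
  · rintro ⟨hC, hat⟩
    refine ⟨hE, h.almostClosed_iff.1 hC, fun G hG => ?_⟩
    by_contra! hcon
    obtain ⟨D, hD⟩ := exists_represents (X := X) hm hG.1 hG.2
    exact hat ⟨D ∩ C, C \ D, inter_subset_right, sdiff_subset,
      (disjoint_sdiff_right (s := D) (t := C)).mono_left inter_subset_left,
      (hD.inter h).almostClosed_iff.2 hcon.1, (h.inter hD.compl).almostClosed_iff.2 hcon.2⟩
  · rintro ⟨-, hE0, hat⟩
    refine ⟨h.almostClosed_iff.2 hE0, ?_⟩
    rintro ⟨A, B, hA, hB, hAB, hA', hB'⟩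
    rcases hat _ (invEvent_L (X := X) (C := A)) with h0 | h0
    · refine hA'.measure_L_ne_zero ?_
      rw [measure_congr ((ae_eq_refl _).inter h.2.symm), inter_eq_left.2 (L_mono hA)] at h0
      exact h0
    · refine hB'.measure_L_ne_zero ?_
      refine measure_mono_null (subset_sdiff.2 ⟨L_mono hB, (disjoint_L hAB).symm⟩) ?_
      exact (measure_congr (h.2.diff (ae_eq_refl (X.L m A)))).trans h0

theorem measure_biUnion_L {𝒞 : Set (Set S)} (hc : 𝒞.Countable) (hd : 𝒞.PairwiseDisjoint id) :
    X.μ (⋃ C ∈ 𝒞, X.L m C) = ∑' C : 𝒞, X.μ (X.L m (C : Set S)) :=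
  measure_biUnion hc (fun _ hC _ hD hne => disjoint_L (hd hC hD hne)) fun _ _ => measurableSet_L

theorem beta_le_of_atoms (hm : 1 ≤ m) {r : ℕ} {F : Fin r → Set (ℕ → S)}
    (hF : ∀ i, X.IsAtomEvent m (F i)) (hdisj : ∀ i j, i ≠ j → X.μ (F i ∩ F j) = 0)
    (hcover : X.μ (⋃ i, F i)ᶜ = 0) : X.beta m ≤ r := by
  choose D hD using fun i => exists_represents (X := X) hm (hF i).1.1 (hF i).1.2
  set C : Fin r → Set S := fun i => D i ∩ ⋂ j ∈ Finset.univ.erase i, (D j)ᶜ with hCdef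
  have hC : ∀ i, X.Represents m (C i) (F i) := fun i => by
    refine ((hD i).inter (Represents.biInter _ fun j => (hD j).compl)).congr ?_
    refine EventuallyLE.antisymm inter_subset_left.eventuallyLE (ae_le_set.2 ?_)
    refine measure_mono_null (t := ⋃ j ∈ Finset.univ.erase i, F i ∩ F j) ?_ ?_
    · intro ω hω
      simpa [hω.1] using hω
    · refine (measure_biUnion_null_iff (Finset.countable_toSet _)).2 fun j hj => hdisj i j ?_
      exact (Finset.ne_of_mem_erase hj).symm
  have hdis : ∀ i j, i ≠ j → Disjoint (C i) (C j) := fun i j hij => by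
    rw [Set.disjoint_left]
    rintro s ⟨hs, -⟩ ⟨-, hs'⟩
    simp only [mem_iInter] at hs'
    exact hs' i (Finset.mem_erase.2 ⟨hij, Finset.mem_univ _⟩) hs
  have hpd : (range C).PairwiseDisjoint id := by
    rintro _ ⟨i, rfl⟩ _ ⟨j, rfl⟩ hij
    exact hdis i j fun h => hij (h ▸ rfl)
  have hat : ∀ A ∈ range C, X.Atomic m A := by
    rintro _ ⟨i, rfl⟩
    exact ((hC i).atomic_iff hm (hF i).1).2 (hF i)
  have hB : X.IsBlackwell m (range C) :=
    { countable := countable_range C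
      almostClosed := fun A hA => (hat A hA).1
      disjoint := hpd
      atMostOneNonatomic := fun A hA _ _ h => absurd (hat A hA) h
      nonatomicNoAtomicSubset := fun A hA h => absurd (hat A hA) h
      nonatomicTransientStates := fun A hA h => absurd (hat A hA) h
      sum_L_eq_one := by
        rw [← measure_biUnion_L (countable_range C) hpd, biUnion_range,
          measure_congr (Filter.EventuallyEq.countable_iUnion fun i => (hC i).2)]
        exact (prob_compl_eq_zero_iff (MeasurableSet.iUnion fun i => (hF i).1.1)).1 hcover }
  refine (sInf_le (mem_image_of_mem _ hB)).trans ?_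
  rw [← image_univ]
  refine (encard_image_le _ _).trans ?_
  simp

theorem le_beta_of_atoms (hm : 1 ≤ m) {r : ℕ} {F : Fin r → Set (ℕ → S)}
    (hF : ∀ i, X.IsAtomEvent m (F i)) (hdisj : ∀ i j, i ≠ j → X.μ (F i ∩ F j) = 0) :
    r ≤ X.beta m := by
  refine le_sInf ?_
  rintro _ ⟨𝒞, h𝒞, rfl⟩
  have hfull : X.μ (⋃ C ∈ 𝒞, X.L m C)ᶜ = 0 := by
    rw [prob_compl_eq_zero_iff (MeasurableSet.biUnion h𝒞.countable fun _ _ => measurableSet_L),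
      measure_biUnion_L h𝒞.countable h𝒞.disjoint, h𝒞.sum_L_eq_one]
  have hex : ∀ i, ∃ C ∈ 𝒞, X.μ (X.L m C ∩ F i) ≠ 0 := by
    intro i
    by_contra! hcon
    refine (hF i).2.1 (measure_mono_null (t := (⋃ C ∈ 𝒞, X.L m C)ᶜ ∪ ⋃ C ∈ 𝒞, X.L m C ∩ F i) ?_
      (measure_union_null hfull ((measure_biUnion_null_iff h𝒞.countable).2 hcon)))
    intro ω hω
    by_cases h : ω ∈ ⋃ C ∈ 𝒞, X.L m C
    · right
      simpa [hω] using h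
    · exact Or.inl h
  choose c hc hcF using hex
  have hinj : Function.Injective c := by
    intro i j hij
    by_contra hne
    have hrep := (h𝒞.almostClosed _ (hc i)).represents
    obtain ⟨D, hD⟩ := exists_represents (X := X) hm (hF i).1.1 (hF i).1.2
    have hsub : X.μ (F i \ X.L m (c i)) = 0 := ((hF i).2.2 _ invEvent_L).resolve_left (hcF i)
    refine h𝒞.nonatomicNoAtomicSubset _ (hc i) (fun hat => ?_) (c i ∩ D) inter_subset_left ?_
    · rcases ((hrep.atomic_iff hm invEvent_L).1 hat).2.2 _ (hF i).1 with h | h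
      · exact hcF i (by rwa [inter_comm])
      · refine hcF j (measure_mono_null ?_ (measure_union_null h (hdisj i j hne)))
        rw [← hij]
        rintro ω ⟨h1, h2⟩
        by_cases h3 : ω ∈ F i
        · exact Or.inr ⟨h3, h2⟩
        · exact Or.inl ⟨h1, h3⟩
    · refine (((hrep.inter hD).congr (EventuallyLE.antisymm inter_subset_right.eventuallyLE
        (ae_le_set.2 ?_))).atomic_iff hm (hF i).1).2 (hF i)
      rwa [sdiff_inter_self_eq_sdiff]
  calc (r : ℕ∞) = (range c).encard := by
        rw [← image_univ, hinj.encard_image]; simp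
    _ ≤ 𝒞.encard := encard_le_encard (range_subset_iff.2 hc)

end Atoms

end MarkovChain

/-- The event that the path shifted by `j` lies in `E`. -/
def shiftEvent {S : Type} (j : ℕ) (E : Set (ℕ → S)) : Set (ℕ → S) := pathShift^[j] ⁻¹' E

namespace MarkovChain

section ShiftEvent

variable {S : Type} {m : ℕ} {E F : Set (ℕ → S)}

theorem shiftEvent_shiftEvent (a b : ℕ) (E : Set (ℕ → S)) :
    shiftEvent a (shiftEvent b E) = shiftEvent (a + b) E := by
  rw [shiftEvent, shiftEvent, ← preimage_comp, ← Function.iterate_add, shiftEvent, add_comm]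

theorem shiftEvent_inter (a : ℕ) (E F : Set (ℕ → S)) :
    shiftEvent a (E ∩ F) = shiftEvent a E ∩ shiftEvent a F := rfl

theorem shiftEvent_diff (a : ℕ) (E F : Set (ℕ → S)) :
    shiftEvent a (E \ F) = shiftEvent a E \ shiftEvent a F := rfl

theorem shiftEvent_iUnion {ι : Sort*} (a : ℕ) (E : ι → Set (ℕ → S)) :
    shiftEvent a (⋃ i, E i) = ⋃ i, shiftEvent a (E i) := preimage_iUnion

variable [MeasurableSpace S]

theorem InvEvent.shiftEvent_mul (hE : InvEvent m E) (c : ℕ) : shiftEvent (m * c) E = E := by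
  rw [mul_comm]
  exact (hE.2.mul c).preimage_eq

theorem InvEvent.shiftEvent_add_mul (hE : InvEvent m E) (j c : ℕ) :
    shiftEvent (j + m * c) E = shiftEvent j E := by
  rw [← shiftEvent_shiftEvent, hE.shiftEvent_mul]

theorem InvEvent.shiftEvent (hE : InvEvent m E) (j : ℕ) : InvEvent m (shiftEvent j E) := by
  refine ⟨measurable_pathShift.iterate j hE.1, minvariant_iff_preimage_eq.2 ?_⟩
  change _root_.shiftEvent m (_root_.shiftEvent j E) = _root_.shiftEvent j E
  rw [shiftEvent_shiftEvent, add_comm]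
  simpa using hE.shiftEvent_add_mul j 1

theorem InvEvent.exists_shiftEvent_eq (hm : 1 ≤ m) (j : ℕ) :
    ∃ b, ∀ E : Set (ℕ → S), InvEvent m E → _root_.shiftEvent b (_root_.shiftEvent j E) = E := by
  refine ⟨j * (m - 1), fun E hE => ?_⟩
  rw [shiftEvent_shiftEvent, ← Nat.mul_succ, Nat.succ_eq_add_one, Nat.sub_add_cancel hm, mul_comm,
    hE.shiftEvent_mul]

theorem InvEvent.iUnion_shiftEvent {l c : ℕ} (hc : 1 ≤ c) (hE : InvEvent (l * c) E) (j : ℕ) :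
    InvEvent l (⋃ i : ℕ, _root_.shiftEvent (j + l * i) E) := by
  refine ⟨MeasurableSet.iUnion fun i => (hE.shiftEvent _).1, minvariant_iff_preimage_eq.2 ?_⟩
  change _root_.shiftEvent l (⋃ i : ℕ, _root_.shiftEvent (j + l * i) E) = _
  rw [shiftEvent_iUnion]
  refine subset_antisymm (iUnion_subset fun i => ?_) (iUnion_subset fun i => ?_)
  · rw [shiftEvent_shiftEvent]
    exact subset_iUnion_of_subset (i + 1) (subset_of_eq (by congr 1; ring))
  · refine subset_iUnion_of_subset (i + (c - 1)) ?_
    rw [shiftEvent_shiftEvent, ← hE.shiftEvent_add_mul (j + l * i) 1]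
    obtain ⟨d, rfl⟩ : ∃ d, c = d + 1 := ⟨c - 1, by lia⟩
    rw [Nat.add_sub_cancel]
    refine subset_of_eq ?_
    congr 1
    ring

end ShiftEvent

section Cyclic

variable {S : Type} [MeasurableSpace S] [MeasurableSingletonClass S] [Countable S]
  {X : MarkovChain S} {m : ℕ} {E F A : Set (ℕ → S)}

theorem InvEvent.measure_shiftEvent_eq_zero (hirr : X.Irreducible) (hap : X.Aperiodic)
    (hm : 1 ≤ m) (hE : InvEvent m E) (h : X.μ E = 0) (j : ℕ) :
    X.μ (_root_.shiftEvent j E) = 0 :=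
  measure_preimage_eq_zero_of_minvariant hirr hap hm hE.1 hE.2 h j

theorem InvEvent.measure_shiftEvent_ne_zero (hirr : X.Irreducible) (hap : X.Aperiodic)
    (hm : 1 ≤ m) (hE : InvEvent m E) (h : X.μ E ≠ 0) (j : ℕ) :
    X.μ (_root_.shiftEvent j E) ≠ 0 := fun h0 => by
  obtain ⟨b, hb⟩ := InvEvent.exists_shiftEvent_eq (S := S) hm j
  have := (hE.shiftEvent j).measure_shiftEvent_eq_zero hirr hap hm h0 b
  rw [hb E hE] at this
  exact h this

theorem InvEvent.shiftEvent_ae_eq (hirr : X.Irreducible) (hap : X.Aperiodic)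
    (hm : 1 ≤ m) (hE : InvEvent m E) (hF : InvEvent m F) (h : E =ᵐ[X.μ] F) (j : ℕ) :
    _root_.shiftEvent j E =ᵐ[X.μ] _root_.shiftEvent j F :=
  EventuallyLE.antisymm
    (ae_le_set.2 ((hE.diff hF).measure_shiftEvent_eq_zero hirr hap hm (ae_le_set.1 h.le) j))
    (ae_le_set.2 ((hF.diff hE).measure_shiftEvent_eq_zero hirr hap hm (ae_le_set.1 h.symm.le) j))

theorem InvEvent.shiftEvent_ae_eq_iff (hirr : X.Irreducible) (hap : X.Aperiodic)
    (hm : 1 ≤ m) (hE : InvEvent m E) (hF : InvEvent m F) (j : ℕ) :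
    _root_.shiftEvent j E =ᵐ[X.μ] _root_.shiftEvent j F ↔ E =ᵐ[X.μ] F := by
  refine ⟨fun h => ?_, fun h => hE.shiftEvent_ae_eq hirr hap hm hF h j⟩
  obtain ⟨b, hb⟩ := InvEvent.exists_shiftEvent_eq (S := S) hm j
  have := (hE.shiftEvent j).shiftEvent_ae_eq hirr hap hm (hF.shiftEvent j) h b
  rwa [hb E hE, hb F hF] at this

theorem IsAtomEvent.shiftEvent (hirr : X.Irreducible) (hap : X.Aperiodic)
    (hm : 1 ≤ m) (hA : X.IsAtomEvent m A) (j : ℕ) : X.IsAtomEvent m (shiftEvent j A) := by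
  refine ⟨hA.1.shiftEvent j, hA.1.measure_shiftEvent_ne_zero hirr hap hm hA.2.1 j, fun G hG => ?_⟩
  obtain ⟨b, hb⟩ := InvEvent.exists_shiftEvent_eq (S := S) hm j
  have hG' : _root_.shiftEvent j (_root_.shiftEvent b G) = G := by
    rw [shiftEvent_shiftEvent, add_comm, ← shiftEvent_shiftEvent, hb G hG]
  have hbG := hG.shiftEvent b
  rw [← hG', ← shiftEvent_inter, ← shiftEvent_diff]
  exact (hA.2.2 _ hbG).imp
    (fun h => (hbG.inter hA.1).measure_shiftEvent_eq_zero hirr hap hm h j)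
    (fun h => (hA.1.diff hbG).measure_shiftEvent_eq_zero hirr hap hm h j)

/-- The shifts of an atom are permuted cyclically. -/
theorem IsAtomEvent.exists_period (hirr : X.Irreducible) (hap : X.Aperiodic) (hm : 1 ≤ m)
    (hA : X.IsAtomEvent m A) : ∃ n, 1 ≤ n ∧ ∀ a b,
      _root_.shiftEvent a A =ᵐ[X.μ] _root_.shiftEvent b A ↔ a ≡ b [MOD n] := by
  classical
  have hex : ∃ n, 1 ≤ n ∧ _root_.shiftEvent n A =ᵐ[X.μ] A :=
    ⟨m, hm, by simpa using (hA.1.shiftEvent_mul 1).eventuallyEq⟩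
  obtain ⟨hn, hnA⟩ := Nat.find_spec hex
  have hmin := fun {k : ℕ} => Nat.find_min (H := hex) (m := k)
  set n := Nat.find hex
  have hadd : ∀ a q, _root_.shiftEvent (a + n * q) A =ᵐ[X.μ] _root_.shiftEvent a A := by
    intro a q
    induction q with
    | zero => rfl
    | succ q ih =>
      have := (hA.1.shiftEvent n).shiftEvent_ae_eq hirr hap hm hA.1 hnA (a + n * q)
      rw [shiftEvent_shiftEvent] at this
      rw [show a + n * (q + 1) = a + n * q + n by ring]
      exact this.trans ih
  have hzero : ∀ d, _root_.shiftEvent d A =ᵐ[X.μ] A ↔ n ∣ d := by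
    intro d
    have hd := hadd (d % n) (d / n)
    rw [Nat.mod_add_div] at hd
    constructor
    · intro h
      by_contra hnd
      exact hmin (Nat.mod_lt d hn) ⟨Nat.pos_of_ne_zero fun h0 => hnd (Nat.dvd_of_mod_eq_zero h0),
        hd.symm.trans h⟩
    · intro h
      rw [Nat.mod_eq_zero_of_dvd h] at hd
      exact hd
  have hle : ∀ a b, a ≤ b →
      (_root_.shiftEvent a A =ᵐ[X.μ] _root_.shiftEvent b A ↔ a ≡ b [MOD n]) := by
    intro a b hab
    obtain ⟨d, rfl⟩ := Nat.exists_eq_add_of_le hab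
    rw [← shiftEvent_shiftEvent, hA.1.shiftEvent_ae_eq_iff hirr hap hm (hA.1.shiftEvent d),
      Nat.modEq_iff_dvd' hab, Nat.add_sub_cancel_left, ← hzero]
    exact ⟨fun h => h.symm, fun h => h.symm⟩
  refine ⟨n, hn, fun a b => ?_⟩
  rcases le_total a b with h | h
  · exact hle a b h
  · rw [Nat.ModEq.comm, ← hle b a h]
    exact ⟨fun h => h.symm, fun h => h.symm⟩

variable (X) in
/-- Triviality of the σ-algebra of shift-invariant events. -/
def TrivialInvariants : Prop := ∀ E, InvEvent 1 E → X.μ E = 0 ∨ X.μ Eᶜ = 0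

theorem TrivialInvariants.measure_compl_iUnion_shiftEvent (ht : X.TrivialInvariants) (hm : 1 ≤ m)
    (hE : InvEvent m E) (h0 : X.μ E ≠ 0) : X.μ (⋃ i, _root_.shiftEvent i E)ᶜ = 0 := by
  have h := InvEvent.iUnion_shiftEvent (l := 1) (E := E) hm (by simpa using hE) 0
  simp only [zero_add, one_mul] at h
  refine (ht _ h).resolve_left fun h1 => h0 (measure_mono_null ?_ h1)
  exact subset_iUnion_of_subset 0 subset_rfl

theorem TrivialInvariants.exists_isAtomEvent (ht : X.TrivialInvariants) (hm : 1 ≤ m) :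
    ∃ A, X.IsAtomEvent m A := by
  by_contra! hno
  have hone : ∀ E, InvEvent m E → X.μ E ≠ 0 →
      1 ≤ ∑ j ∈ Finset.range m, X.μ (_root_.shiftEvent j E) := by
    intro E hE h0
    have hU : ⋃ i, _root_.shiftEvent i E ⊆ ⋃ j ∈ Finset.range m, _root_.shiftEvent j E := by
      refine iUnion_subset fun i => ?_
      rw [← Nat.mod_add_div i m, hE.shiftEvent_add_mul]
      exact subset_biUnion_of_mem (u := fun j => _root_.shiftEvent j E)
        (Finset.mem_coe.2 (Finset.mem_range.2 (Nat.mod_lt i hm)))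
    have h1 : X.μ (⋃ i, _root_.shiftEvent i E) = 1 :=
      (prob_compl_eq_zero_iff (MeasurableSet.iUnion fun i => (hE.shiftEvent i).1)).1
        (ht.measure_compl_iUnion_shiftEvent hm hE h0)
    rw [← h1]
    exact (measure_mono hU).trans (measure_biUnion_finset_le _ _)
  have hlow : ∀ r : ℕ, ∀ E, InvEvent m E → X.μ E ≠ 0 →
      (r : ENNReal) ≤ ∑ j ∈ Finset.range m, X.μ (_root_.shiftEvent j E) := by
    intro r
    induction r with
    | zero => simp
    | succ r ih =>
      intro E hE h0
      have := hno E
      simp only [IsAtomEvent, not_and, not_forall, not_or] at this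
      obtain ⟨G, hG, hG1, hG2⟩ := this hE h0
      rw [Nat.cast_add, Nat.cast_one]
      refine (add_le_add (ih _ (hG.inter hE) hG1) (hone _ (hE.diff hG) hG2)).trans ?_
      rw [← Finset.sum_add_distrib]
      refine Finset.sum_le_sum fun j _ => ?_
      rw [shiftEvent_inter, shiftEvent_diff, inter_comm,
        measure_inter_add_sdiff _ (hG.shiftEvent j).1]
  have := hlow (m + 1) univ ⟨MeasurableSet.univ, fun _ => by simp⟩ (by simp)
  simp only [_root_.shiftEvent, preimage_univ, measure_univ, Finset.sum_const, Finset.card_range,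
    nsmul_eq_mul, mul_one, Nat.cast_le] at this
  lia

theorem _root_.Nat.exists_add_mul_modEq {n : ℕ} (hn : 1 ≤ n) (l a : ℕ) :
    ∃ i, a % n.gcd l + l * i ≡ a [MOD n] := by
  refine ⟨(Nat.gcdB n l * (a / n.gcd l : ℕ) % n).toNat, ?_⟩
  have hn' : (n : ℤ) ≠ 0 := by exact_mod_cast (by lia : n ≠ 0)
  rw [← Int.natCast_modEq_iff]
  push_cast
  rw [Int.toNat_of_nonneg (Int.emod_nonneg _ hn')]
  refine (((Int.mod_modEq _ _).mul_left _).add_left _).trans ?_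
  have h1 : (a : ℤ) = a % (n.gcd l : ℕ) + (n.gcd l : ℕ) * (a / (n.gcd l : ℕ)) :=
    (Int.emod_add_mul_ediv _ _).symm
  refine Int.modEq_iff_dvd.2 ⟨Nat.gcdA n l * (a / (n.gcd l : ℕ)), ?_⟩
  have h2 := Nat.gcd_eq_gcd_ab n l
  linear_combination h1 + (a / (n.gcd l : ℕ) : ℤ) * h2

theorem IsAtomEvent.iUnion_shiftEvent (hirr : X.Irreducible) (hap : X.Aperiodic) {l c : ℕ}
    (hl : 1 ≤ l) (hc : 1 ≤ c) (hA : X.IsAtomEvent (l * c) A) (j : ℕ) :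
    X.IsAtomEvent l (⋃ i : ℕ, _root_.shiftEvent (j + l * i) A) := by
  have hm : 1 ≤ l * c := Nat.mul_pos hl hc
  refine ⟨hA.1.iUnion_shiftEvent hc j, fun h0 => ?_, fun G hG => ?_⟩
  · exact hA.1.measure_shiftEvent_ne_zero hirr hap hm hA.2.1 _
      (measure_iUnion_null_iff.1 h0 0)
  · have hG' : InvEvent (l * c) G := mul_comm c l ▸ hG.mul c
    rw [or_iff_not_imp_left, inter_iUnion, iUnion_sdiff, measure_iUnion_null_iff,
      measure_iUnion_null_iff]
    intro hne i'
    push Not at hne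
    obtain ⟨i, hi⟩ := hne
    have hAi := hA.shiftEvent hirr hap hm (j + l * i)
    have h0 := (hAi.2.2 G hG').resolve_left hi
    obtain ⟨t, ht⟩ : ∃ t, i' + c * i = i + t :=
      ⟨i' + c * i - i, by have := Nat.le_mul_of_pos_left i hc; lia⟩
    have h1 := (hAi.1.diff hG').measure_shiftEvent_eq_zero hirr hap hm h0 (l * t)
    rw [shiftEvent_diff, hG.shiftEvent_mul, shiftEvent_shiftEvent,
      show l * t + (j + l * i) = j + l * (i + t) by ring, ← ht,
      show j + l * (i' + c * i) = j + l * i' + l * c * i by ring, hA.1.shiftEvent_add_mul] at h1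
    exact h1

theorem TrivialInvariants.exists_beta_eq_gcd (ht : X.TrivialInvariants) (hirr : X.Irreducible)
    (hap : X.Aperiodic) (hm : 1 ≤ m) :
    ∃ n, 1 ≤ n ∧ ∀ l, l ∣ m → X.beta l = (n.gcd l : ℕ) := by
  obtain ⟨A, hA⟩ := ht.exists_isAtomEvent hm
  obtain ⟨n, hn, hper⟩ := hA.exists_period hirr hap hm
  refine ⟨n, hn, ?_⟩
  rintro l ⟨c, rfl⟩
  have hl : 1 ≤ l := Nat.pos_of_mul_pos_right hm
  have hc : 1 ≤ c := Nat.pos_of_mul_pos_left hm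
  have hg : 0 < n.gcd l := Nat.gcd_pos_of_pos_left _ hn
  set F : Fin (n.gcd l) → Set (ℕ → S) := fun j => ⋃ i : ℕ, _root_.shiftEvent (j + l * i) A
  have hF : ∀ j, X.IsAtomEvent l (F j) := fun j => hA.iUnion_shiftEvent hirr hap hl hc j
  have hdisj : ∀ j j', j ≠ j' → X.μ (F j ∩ F j') = 0 := by
    intro j j' hne
    rw [iUnion_inter_iUnion]
    simp only [measure_iUnion_null_iff]
    by_contra! hcon
    obtain ⟨i, i', hi⟩ := hcon
    have h := (hper _ _).1 ((hA.shiftEvent hirr hap hm _).ae_eq (hA.shiftEvent hirr hap hm _) hi)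
    have h' := h.of_dvd (Nat.gcd_dvd_left n l)
    have hz : ∀ x, l * x ≡ 0 [MOD n.gcd l] := fun x =>
      Nat.modEq_zero_iff_dvd.2 (Dvd.dvd.mul_right (Nat.gcd_dvd_right n l) x)
    have h'' : (j : ℕ) ≡ j' [MOD n.gcd l] := by
      simpa using (((hz i).symm.add_left j).trans h').trans ((hz i').add_left j')
    exact hne (Fin.ext (Nat.ModEq.eq_of_lt_of_lt h'' j.2 j'.2))
  have hcover : X.μ (⋃ j, F j)ᶜ = 0 := by
    have hV := ht.measure_compl_iUnion_shiftEvent hm hA.1 hA.2.1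
    have hsub : X.μ ((⋃ i, _root_.shiftEvent i A) \ ⋃ j, F j) = 0 := by
      rw [iUnion_sdiff, measure_iUnion_null_iff]
      intro a
      obtain ⟨i, hi⟩ := Nat.exists_add_mul_modEq hn l a
      refine measure_mono_null ?_ (ae_le_set.1 ((hper _ _).2 hi).symm.le)
      refine sdiff_subset_sdiff_right ?_
      refine subset_iUnion_of_subset ⟨a % n.gcd l, Nat.mod_lt _ hg⟩ ?_
      exact subset_iUnion_of_subset i subset_rfl
    refine measure_mono_null (fun ω hω => ?_) (measure_union_null hV hsub)
    by_cases h : ω ∈ ⋃ i, _root_.shiftEvent i A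
    · exact Or.inr ⟨h, hω⟩
    · exact Or.inl h
  exact le_antisymm (beta_le_of_atoms hl hF hdisj hcover) (le_beta_of_atoms hl hF hdisj)

end Cyclic

section Simple

variable {S : Type} [MeasurableSpace S] {X : MarkovChain S} {m : ℕ}

theorem Simple.exists_isBlackwell (h : X.Simple) : ∃ C, X.IsBlackwell 1 {C} := by
  have hne : (Set.encard '' {𝒞 : Set (Set S) | X.IsBlackwell 1 𝒞}).Nonempty := by
    by_contra h0
    rw [not_nonempty_iff_eq_empty] at h0
    rw [Simple, beta, h0, sInf_empty] at h
    exact ENat.top_ne_one h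
  obtain ⟨𝒞, h𝒞, h1⟩ := csInf_mem hne
  obtain ⟨C, rfl⟩ := encard_eq_one.1 (h1.trans h)
  exact ⟨C, h𝒞⟩

theorem IsBlackwell.measure_L {C : Set S} (h : X.IsBlackwell m {C}) : X.μ (X.L m C) = 1 := by
  have := h.sum_L_eq_one
  rwa [tsum_singleton C fun D => X.μ (X.L m D)] at this

variable [MeasurableSingletonClass S] [Countable S]

theorem IsBlackwell.measure_compl_L {C : Set S} (h : X.IsBlackwell m {C}) :
    X.μ (X.L m C)ᶜ = 0 :=
  (prob_compl_eq_zero_iff measurableSet_L).2 h.measure_L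

theorem IsBlackwell.trivialInvariants {C : Set S} (h : X.IsBlackwell 1 {C})
    (hC : X.Atomic 1 C) : X.TrivialInvariants := by
  intro E hE
  refine (((hC.1.represents.atomic_iff le_rfl invEvent_L).1 hC).2.2 E hE).imp (fun h0 => ?_)
    fun h0 => ?_
  · exact measure_mono_null (fun ω hω => (em (ω ∈ X.L 1 C)).imp (fun h1 => ⟨hω, h1⟩) id)
      (measure_union_null h0 h.measure_compl_L)
  · exact measure_mono_null (fun ω hω => (em (ω ∈ X.L 1 C)).imp (fun h1 => ⟨h1, hω⟩) id)
      (measure_union_null h0 h.measure_compl_L)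

theorem IsBlackwell.not_isAtomEvent {C : Set S} (h : X.IsBlackwell 1 {C})
    (hC : ¬ X.Atomic 1 C) (hirr : X.Irreducible) (hap : X.Aperiodic) (hm : 1 ≤ m)
    (A : Set (ℕ → S)) : ¬ X.IsAtomEvent m A := by
  intro hA
  have hV := IsAtomEvent.iUnion_shiftEvent (l := 1) hirr hap le_rfl hm (by simpa using hA) 0
  obtain ⟨B, hB⟩ := exists_represents (X := X) le_rfl hV.1.1 hV.1.2
  refine h.nonatomicNoAtomicSubset C rfl hC (C ∩ B) inter_subset_left ?_
  refine ((((h.almostClosed C rfl).represents.inter hB).congr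
    (EventuallyLE.antisymm inter_subset_right.eventuallyLE (ae_le_set.2 ?_))).atomic_iff
      le_rfl hV.1).2 hV
  rw [sdiff_inter_self_eq_sdiff]
  exact measure_mono_null (fun ω hω => hω.2) h.measure_compl_L

theorem IsBlackwell.beta_eq_one {C : Set S} (h : X.IsBlackwell 1 {C})
    (hC : ¬ X.Atomic 1 C) (hirr : X.Irreducible) (hap : X.Aperiodic) (hm : 1 ≤ m) :
    X.beta m = 1 := by
  have hL : X.L m univ = univ := by ext; simp [L]
  have hac : X.AlmostClosed m univ := represents_univ.almostClosed_iff.2 (by simp)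
  have hno : ∀ A, ¬ X.Atomic m A := fun A hA =>
    h.not_isAtomEvent hC hirr hap hm _ ((hA.1.represents.atomic_iff hm invEvent_L).1 hA)
  refine le_antisymm (sInf_le ⟨{univ}, ?_, encard_singleton _⟩) (le_sInf ?_)
  · refine
      { countable := countable_singleton _
        almostClosed := by rintro _ rfl; exact hac
        disjoint := pairwiseDisjoint_singleton _ _
        atMostOneNonatomic := by rintro _ rfl _ rfl _ _; rfl
        nonatomicNoAtomicSubset := fun _ _ _ A _ => hno A
        nonatomicTransientStates := fun _ _ _ i _ => ?_
        sum_L_eq_one := by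
          rw [tsum_singleton univ fun D => X.μ (X.L m D), hL, measure_univ] }
    have hsub : X.U m {i} ⊆ X.U 1 {i} := fun ω hω n =>
      let ⟨k, hk, hki⟩ := hω n
      ⟨k * m, hk.trans (Nat.le_mul_of_pos_right k hm), by rwa [mul_one]⟩
    by_cases hi : i ∈ C
    · exact measure_mono_null hsub (h.nonatomicTransientStates C rfl hC i hi)
    · refine measure_mono_null ?_ h.measure_compl_L
      rw [← U_compl]
      exact hsub.trans (U_mono (singleton_subset_iff.2 hi))
  · rintro _ ⟨𝒞, h𝒞, rfl⟩
    rw [one_le_encard_iff_nonempty]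
    by_contra h0
    rw [not_nonempty_iff_eq_empty] at h0
    subst h0
    simpa using h𝒞.sum_L_eq_one

end Simple

end MarkovChain

variable {S : Type} [MeasurableSpace S] [MeasurableSingletonClass S]
  [Countable S] [Infinite S]

/-- Let `X` be simple and `k, ℓ ≥ 1`. Then
`β(X^(kℓ)) = κ · β(X^(ℓ))` for some positive integer `κ` dividing `β(X^(k))`. -/
theorem stmt6 (X : MarkovChain S) (hirr : X.Irreducible) (hap : X.Aperiodic)
    (hsimple : X.Simple) (k l : ℕ) (hk : 1 ≤ k) (hl : 1 ≤ l) :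
    ∃ κ : ℕ, 0 < κ ∧ X.beta (k * l) = (κ : ℕ∞) * X.beta l ∧
      (κ : ℕ∞) ∣ X.beta k := by
  have hkl : 1 ≤ k * l := Nat.mul_pos hk hl
  obtain ⟨C, hC⟩ := hsimple.exists_isBlackwell
  by_cases hat : X.Atomic 1 C
  · obtain ⟨n, hn, hbeta⟩ := (hC.trivialInvariants hat).exists_beta_eq_gcd hirr hap hkl
    rw [hbeta _ dvd_rfl, hbeta _ (dvd_mul_left l k), hbeta _ (dvd_mul_right k l)]
    obtain ⟨κ, hκ⟩ : n.gcd l ∣ n.gcd (k * l) :=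
      Nat.gcd_dvd_gcd_of_dvd_right _ (dvd_mul_left l k)
    have hg : 0 < n.gcd l := Nat.gcd_pos_of_pos_left _ hn
    refine ⟨κ, ?_, ?_, ?_⟩
    · refine Nat.pos_of_ne_zero fun h0 => ?_
      rw [h0, mul_zero] at hκ
      exact (Nat.gcd_pos_of_pos_left _ hn).ne' hκ
    · rw [hκ, mul_comm, Nat.cast_mul]
    · have hdvd : κ ∣ n.gcd k := by
        refine Nat.dvd_gcd ?_ ?_
        · exact (Dvd.intro_left _ hκ.symm).trans (Nat.gcd_dvd_left _ _)
        · refine Nat.dvd_of_mul_dvd_mul_left hg ?_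
          rw [← hκ]
          have h1 : n.gcd (k * l) ∣ (k * n).gcd (k * l) :=
            Nat.gcd_dvd_gcd_of_dvd_left _ (dvd_mul_left n k)
          rwa [Nat.gcd_mul_left, mul_comm k (n.gcd l)] at h1
      exact Nat.cast_dvd_cast hdvd
  · have h1 : ∀ m, 1 ≤ m → X.beta m = 1 := fun m hm => hC.beta_eq_one hat hirr hap hm
    exact ⟨1, one_pos, by rw [h1 _ hkl, h1 _ hl]; simp, by rw [h1 _ hk]; simp⟩
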